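/- arXiv:2109.09078 — 6 statements merged into one kernel-verified Lean document; each statement's English description precedes it below -/
import Mathlib

section
/- Let f₁ and f₂ be trade-off functions. Then the lower convex envelope lce{f₁, f₂} of f₁ and f₂ is itself a trade-off function; that is, on [0,1] it is convex, continuous, non-increasing, takes values in [0,1], and satisfies lce{f₁,f₂}(x) ≤ 1 − x for all x ∈ [0,1]. -/
/-- A trade-off function: convex, continuous, non-increasing on `[0,1]`,
taking values in `[0,1]` and satisfying `f x ≤ 1 - x` on `[0,1]`. -/
def IsTradeoff (f : ℝ → ℝ) : Prop :=
  ConvexOn ℝ (Set.Icc 0 1) f ∧ ContinuousOn f (Set.Icc 0 1) ∧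
    AntitoneOn f (Set.Icc 0 1) ∧
    ∀ x ∈ Set.Icc (0 : ℝ) 1, f x ∈ Set.Icc (0 : ℝ) 1 ∧ f x ≤ 1 - x

/-- The lower convex envelope of two functions on `[0,1]`:
`lce f₁ f₂ x = sup { g x : g convex on [0,1], g ≤ min (f₁, f₂) on [0,1] }`. -/
noncomputable def lce (f₁ f₂ : ℝ → ℝ) : ℝ → ℝ := fun x =>
  sSup {y : ℝ | ∃ g : ℝ → ℝ, ConvexOn ℝ (Set.Icc 0 1) g ∧
    (∀ z ∈ Set.Icc (0 : ℝ) 1, g z ≤ min (f₁ z) (f₂ z)) ∧ y = g x}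

section Envelope

open Set Filter Topology

variable {f₁ f₂ : ℝ → ℝ}

theorem le_lce {g : ℝ → ℝ} (hg : ConvexOn ℝ (Icc 0 1) g)
    (hle : ∀ z ∈ Icc (0 : ℝ) 1, g z ≤ min (f₁ z) (f₂ z)) {x : ℝ} (hx : x ∈ Icc (0 : ℝ) 1) :
    g x ≤ lce f₁ f₂ x := by
  refine le_csSup ⟨min (f₁ x) (f₂ x), ?_⟩ ⟨g, hg, hle, rfl⟩
  rintro _ ⟨k, -, hk, rfl⟩
  exact hk x hx

theorem lce_le_of_forall_le (h₁ : IsTradeoff f₁) (h₂ : IsTradeoff f₂) {x c : ℝ}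
    (h : ∀ g : ℝ → ℝ, ConvexOn ℝ (Icc 0 1) g →
      (∀ z ∈ Icc (0 : ℝ) 1, g z ≤ min (f₁ z) (f₂ z)) → g x ≤ c) :
    lce f₁ f₂ x ≤ c := by
  refine csSup_le ⟨0, fun _ => 0, convexOn_const 0 (convex_Icc 0 1), fun z hz => ?_, rfl⟩ ?_
  · exact le_min (h₁.2.2.2 z hz).1.1 (h₂.2.2.2 z hz).1.1
  · rintro _ ⟨g, hg, hle, rfl⟩
    exact h g hg hle

theorem lce_nonneg (h₁ : IsTradeoff f₁) (h₂ : IsTradeoff f₂) {x : ℝ}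
    (hx : x ∈ Icc (0 : ℝ) 1) : 0 ≤ lce f₁ f₂ x :=
  le_lce (g := fun _ => 0) (convexOn_const 0 (convex_Icc 0 1))
    (fun z hz => le_min (h₁.2.2.2 z hz).1.1 (h₂.2.2.2 z hz).1.1) hx

theorem lce_le_min (h₁ : IsTradeoff f₁) (h₂ : IsTradeoff f₂) {x : ℝ}
    (hx : x ∈ Icc (0 : ℝ) 1) : lce f₁ f₂ x ≤ min (f₁ x) (f₂ x) :=
  lce_le_of_forall_le h₁ h₂ fun _ _ hle => hle x hx

theorem lce_le_one_sub (h₁ : IsTradeoff f₁) (h₂ : IsTradeoff f₂) {x : ℝ}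
    (hx : x ∈ Icc (0 : ℝ) 1) : lce f₁ f₂ x ≤ 1 - x :=
  ((lce_le_min h₁ h₂ hx).trans (min_le_left _ _)).trans (h₁.2.2.2 x hx).2

theorem convexOn_lce (h₁ : IsTradeoff f₁) (h₂ : IsTradeoff f₂) :
    ConvexOn ℝ (Icc 0 1) (lce f₁ f₂) := by
  refine ⟨convex_Icc 0 1, fun x hx y hy a b ha hb hab => ?_⟩
  refine lce_le_of_forall_le h₁ h₂ fun g hg hle => (hg.2 hx hy ha hb hab).trans ?_
  exact add_le_add (smul_le_smul_of_nonneg_left (le_lce hg hle hx) ha)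
    (smul_le_smul_of_nonneg_left (le_lce hg hle hy) hb)

/-- A nonnegative convex function on `[0,1]` lying below `1 - x` is non-increasing. -/
theorem ConvexOn.antitoneOn_of_le_one_sub {F : ℝ → ℝ} (hF : ConvexOn ℝ (Icc 0 1) F)
    (h0 : ∀ x ∈ Icc (0 : ℝ) 1, 0 ≤ F x) (h1 : ∀ x ∈ Icc (0 : ℝ) 1, F x ≤ 1 - x) :
    AntitoneOn F (Icc 0 1) := by
  intro x hx y hy hxy
  have one_mem : (1 : ℝ) ∈ Icc (0 : ℝ) 1 := by simp
  have hF1 : F 1 ≤ F x := by linarith [h1 1 one_mem, h0 x hx]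
  have hseg : y ∈ segment ℝ x 1 := by
    rw [segment_eq_Icc hx.2]
    exact ⟨hxy, hy.2⟩
  simpa [max_eq_left hF1] using hF.le_on_segment hx one_mem hseg

/-- Near `0` the envelope is bounded below by an affine minorant
with value `min (f₁ 0) (f₂ 0) - ε / 2` at `0`. -/
theorem continuousWithinAt_lce_zero (h₁ : IsTradeoff f₁) (h₂ : IsTradeoff f₂)
    (hanti : AntitoneOn (lce f₁ f₂) (Icc 0 1)) :
    ContinuousWithinAt (lce f₁ f₂) (Icc 0 1) 0 := by
  have zero_mem : (0 : ℝ) ∈ Icc (0 : ℝ) 1 := by simp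
  set m := min (f₁ 0) (f₂ 0) with hm
  have hF0 : lce f₁ f₂ 0 ≤ m := lce_le_min h₁ h₂ zero_mem
  have hcont : ContinuousWithinAt (fun z => min (f₁ z) (f₂ z)) (Icc 0 1) 0 :=
    Tendsto.min (h₁.2.1 0 zero_mem) (h₂.2.1 0 zero_mem)
  have hm0 : 0 ≤ m := le_min (h₁.2.2.2 0 zero_mem).1.1 (h₂.2.2.2 0 zero_mem).1.1
  rw [Metric.continuousWithinAt_iff] at hcont ⊢
  intro ε hε
  obtain ⟨δ, hδ, hclose⟩ := hcont (ε / 2) (by positivity)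
  have hminor : ∀ x ∈ Icc (0 : ℝ) 1, m - ε / 2 - m / δ * x ≤ lce f₁ f₂ x := by
    intro x hx
    refine le_lce (g := fun x => m - ε / 2 - m / δ * x)
      ⟨convex_Icc 0 1, fun u _ v _ a b _ _ hab => le_of_eq ?_⟩ (fun z hz => ?_) hx
    · simp only [smul_eq_mul]
      linear_combination (-(m - ε / 2)) * hab
    · have hmz : 0 ≤ m / δ * z := mul_nonneg (by positivity) hz.1
      rcases lt_or_ge z δ with hzδ | hzδ
      · have h := hclose hz (by rwa [Real.dist_eq, sub_zero, abs_of_nonneg hz.1])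
        rw [Real.dist_eq, ← hm] at h
        linarith [(abs_lt.1 h).1]
      · have h : m ≤ m / δ * z := by
          rw [div_mul_eq_mul_div, le_div_iff₀ hδ]
          exact mul_le_mul_of_nonneg_left hzδ hm0
        have hpos : 0 ≤ min (f₁ z) (f₂ z) :=
          le_min (h₁.2.2.2 z hz).1.1 (h₂.2.2.2 z hz).1.1
        linarith
  refine ⟨ε / 2 / (m / δ + 1), by positivity, fun x hx hxd => ?_⟩
  rw [Real.dist_eq, sub_zero, abs_of_nonneg hx.1, lt_div_iff₀ (by positivity)] at hxd
  rw [Real.dist_eq, abs_lt]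
  constructor
  · linarith [hminor x hx, hx.1]
  · linarith [hanti zero_mem hx hx.1]

theorem continuousWithinAt_lce_one (h₁ : IsTradeoff f₁) (h₂ : IsTradeoff f₂) :
    ContinuousWithinAt (lce f₁ f₂) (Icc 0 1) 1 := by
  have one_mem : (1 : ℝ) ∈ Icc (0 : ℝ) 1 := by simp
  have hF1 : lce f₁ f₂ 1 = 0 :=
    le_antisymm (by simpa using lce_le_one_sub h₁ h₂ one_mem) (lce_nonneg h₁ h₂ one_mem)
  have hlim : Tendsto (fun x : ℝ => 1 - x) (𝓝[Icc 0 1] 1) (𝓝 0) := by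
    have h : ContinuousWithinAt (fun x : ℝ => 1 - x) (Icc 0 1) 1 := by fun_prop
    simpa [ContinuousWithinAt] using h
  rw [ContinuousWithinAt, hF1]
  refine tendsto_of_tendsto_of_tendsto_of_le_of_le' tendsto_const_nhds hlim ?_ ?_
  · filter_upwards [self_mem_nhdsWithin] with x hx using lce_nonneg h₁ h₂ hx
  · filter_upwards [self_mem_nhdsWithin] with x hx using lce_le_one_sub h₁ h₂ hx

end Envelope

/-- The lower convex envelope of two trade-off functions is a trade-off function. -/
theorem lce_isTradeoff (f₁ f₂ : ℝ → ℝ) (h₁ : IsTradeoff f₁) (h₂ : IsTradeoff f₂) :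
    IsTradeoff (lce f₁ f₂) := by
  have hconv := convexOn_lce h₁ h₂
  have hanti := hconv.antitoneOn_of_le_one_sub (fun _ => lce_nonneg h₁ h₂)
    (fun _ => lce_le_one_sub h₁ h₂)
  refine ⟨hconv, fun x hx => ?_, hanti, fun x hx => ?_⟩
  · rcases hx.1.eq_or_lt with rfl | hx0
    · exact continuousWithinAt_lce_zero h₁ h₂ hanti
    rcases hx.2.eq_or_lt with rfl | hx1
    · exact continuousWithinAt_lce_one h₁ h₂
    have hint : x ∈ interior (Set.Icc (0 : ℝ) 1) := by
      rw [interior_Icc]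
      exact ⟨hx0, hx1⟩
    exact (hconv.continuousOn_interior.continuousAt
      (isOpen_interior.mem_nhds hint)).continuousWithinAt
  · have hle := lce_le_one_sub h₁ h₂ hx
    exact ⟨⟨lce_nonneg h₁ h₂ hx, by linarith [hx.1]⟩, hle⟩
end

section
/- Let P and Q be probability measures on a measurable space Ω and let R be a probability measure on a measurable space Ω′. Then for all α ∈ [0,1], T(P × R, Q × R)(α) = T(P, Q)(α), where × denotes the product measure. (That is, tensoring a trade-off function with the trade-off function Id of two identical distributions leaves it unchanged: f ⊗ Id = f.) -/
open MeasureTheory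

/-- The trade-off function `T(P, P')(α)`: the infimum of type-II errors
`1 - ∫ φ dP'` over measurable rejection rules `0 ≤ φ ≤ 1` with type-I error
`∫ φ dP ≤ α`. -/
noncomputable def tradeOff {Ω : Type*} [MeasurableSpace Ω] (P P' : Measure Ω) (α : ℝ) : ℝ :=
  sInf {β : ℝ | ∃ φ : Ω → ℝ, Measurable φ ∧ (∀ ω, φ ω ∈ Set.Icc (0 : ℝ) 1) ∧
    (∫ ω, φ ω ∂P) ≤ α ∧ β = 1 - ∫ ω, φ ω ∂P'}

/-- A measurable function with values in `[0, 1]` is integrable for a finite measure. -/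
theorem integrable_of_mem_Icc_zero_one {X : Type*} [MeasurableSpace X] {μ : Measure X}
    [IsFiniteMeasure μ] {f : X → ℝ} (hf : Measurable f) (hmem : ∀ x, f x ∈ Set.Icc (0 : ℝ) 1) :
    Integrable f μ :=
  Integrable.of_mem_Icc 0 1 hf.aemeasurable (.of_forall hmem)

/-- Tensoring with the trade-off function of two identical distributions leaves a
trade-off function unchanged: `T(P × R, Q × R)(α) = T(P, Q)(α)` for all `α ∈ [0,1]`,
i.e., `f ⊗ Id = f`. -/
theorem tradeOff_prod_right {Ω Ω' : Type*} [MeasurableSpace Ω] [MeasurableSpace Ω']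
    (P Q : Measure Ω) (R : Measure Ω')
    [IsProbabilityMeasure P] [IsProbabilityMeasure Q] [IsProbabilityMeasure R] :
    ∀ α ∈ Set.Icc (0 : ℝ) 1, tradeOff (P.prod R) (Q.prod R) α = tradeOff P Q α := by
  intro α _
  unfold tradeOff
  congr 1
  ext β
  constructor
  · rintro ⟨φ, hφ, hmem, hα, rfl⟩
    refine ⟨fun x => (∫ y, φ (x, y) ∂(R)),
      hφ.stronglyMeasurable.integral_prod_right'.measurable, fun x => ⟨?_, ?_⟩, ?_, ?_⟩
    · exact integral_nonneg fun y => (hmem (x, y)).1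
    · calc ∫ y, φ (x, y) ∂(R) ≤ ∫ _, (1 : ℝ) ∂(R) :=
            integral_mono_of_nonneg (.of_forall fun y => (hmem (x, y)).1)
              (integrable_const 1) (.of_forall fun y => (hmem (x, y)).2)
        _ = 1 := by simp
    · rwa [← integral_prod φ (integrable_of_mem_Icc_zero_one hφ hmem)]
    · rw [← integral_prod φ (integrable_of_mem_Icc_zero_one hφ hmem)]
  · rintro ⟨φ, hφ, hmem, hα, rfl⟩
    refine ⟨fun z => φ z.1, hφ.comp measurable_fst, fun z => hmem z.1, ?_, ?_⟩
    · simpa [integral_fun_fst] using hα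
    · simp [integral_fun_fst]
end

section
/- Parallel composition in f-differential privacy (non-adaptive form): Let 𝔻₁ and 𝔻₂ be disjoint subsets of the row set X. For i = 1, 2 let Mᵢ map each data set to a probability measure on a measurable space Rᵢ, and suppose there are functions fᵢ : [0,1] → ℝ such that for all neighboring data sets D, D′ and all α ∈ [0,1], T(Mᵢ(D ∩ 𝔻ᵢ), Mᵢ(D′ ∩ 𝔻ᵢ))(α) ≥ fᵢ(α). Then the joint mechanism M(D) := M₁(D ∩ 𝔻₁) × M₂(D ∩ 𝔻₂) (product measure) satisfies T(M(D), M(D′))(α) ≥ min(f₁(α), f₂(α)) for every pair of neighboring data sets D, D′ and every α ∈ [0,1]. -/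
open MeasureTheory

/-- Two data sets (finite multisets over the row set `X`) are neighboring if one is
obtained from the other by adding a single row. -/
def Neighboring {X : Type*} (D D' : Multiset X) : Prop :=
  ∃ x : X, D' = D + {x} ∨ D = D' + {x}

theorem integrable_of_forall_mem_Icc {Ω : Type*} [MeasurableSpace Ω] (P : Measure Ω)
    [IsFiniteMeasure P] {φ : Ω → ℝ} (hφ : Measurable φ) (hφ01 : ∀ ω, φ ω ∈ Set.Icc (0 : ℝ) 1) :
    Integrable φ P :=
  .of_mem_Icc 0 1 hφ.aemeasurable (.of_forall hφ01)

theorem integral_mem_Icc_of_forall_mem_Icc {Ω : Type*} [MeasurableSpace Ω] (P : Measure Ω)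
    [IsProbabilityMeasure P] {φ : Ω → ℝ} (hφ01 : ∀ ω, φ ω ∈ Set.Icc (0 : ℝ) 1) :
    ∫ ω, φ ω ∂P ∈ Set.Icc (0 : ℝ) 1 := by
  refine ⟨integral_nonneg fun ω => (hφ01 ω).1, ?_⟩
  have : ∫ ω, φ ω ∂P ≤ ∫ _, (1 : ℝ) ∂P :=
    integral_mono_of_nonneg (.of_forall fun ω => (hφ01 ω).1) (integrable_const 1)
      (.of_forall fun ω => (hφ01 ω).2)
  simpa using this

theorem tradeOff_le_of_forall_exists {Ω Ω' : Type*} [MeasurableSpace Ω] [MeasurableSpace Ω']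
    {P P' : Measure Ω} {Q Q' : Measure Ω'} [IsProbabilityMeasure P'] {α : ℝ} (hα : 0 ≤ α)
    (h : ∀ φ : Ω' → ℝ, Measurable φ → (∀ ω, φ ω ∈ Set.Icc (0 : ℝ) 1) →
      ∃ ψ : Ω → ℝ, Measurable ψ ∧ (∀ ω, ψ ω ∈ Set.Icc (0 : ℝ) 1) ∧
        ∫ ω, ψ ω ∂P = ∫ ω, φ ω ∂Q ∧ ∫ ω, ψ ω ∂P' = ∫ ω, φ ω ∂Q') :
    tradeOff P P' α ≤ tradeOff Q Q' α := by
  refine le_csInf ⟨1, fun _ => 0, measurable_const, by simp, by simpa using hα, by simp⟩ ?_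
  rintro _ ⟨φ, hφ, hφ01, hφα, rfl⟩
  obtain ⟨ψ, hψ, hψ01, hP, hP'⟩ := h φ hφ hφ01
  refine csInf_le ⟨0, ?_⟩ ⟨ψ, hψ, hψ01, hP.trans_le hφα, by rw [hP']⟩
  rintro _ ⟨χ, -, hχ01, -, rfl⟩
  exact sub_nonneg.2 (integral_mem_Icc_of_forall_mem_Icc P' hχ01).2

theorem tradeOff_le_tradeOff_prod_right {Ω Ω' : Type*} [MeasurableSpace Ω] [MeasurableSpace Ω']
    (P P' : Measure Ω) (Q : Measure Ω') [IsProbabilityMeasure P] [IsProbabilityMeasure P']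
    [IsProbabilityMeasure Q] {α : ℝ} (hα : 0 ≤ α) :
    tradeOff P P' α ≤ tradeOff (P.prod Q) (P'.prod Q) α := by
  refine tradeOff_le_of_forall_exists hα fun φ hφ hφ01 =>
    ⟨fun x => ∫ y, φ (x, y) ∂Q, ?_, fun x => integral_mem_Icc_of_forall_mem_Icc Q fun y => hφ01 _,
      ?_, ?_⟩
  · exact hφ.stronglyMeasurable.integral_prod_right'.measurable
  · exact (integral_prod φ (integrable_of_forall_mem_Icc _ hφ hφ01)).symm
  · exact (integral_prod φ (integrable_of_forall_mem_Icc _ hφ hφ01)).symm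

theorem tradeOff_le_tradeOff_prod_left {Ω Ω' : Type*} [MeasurableSpace Ω] [MeasurableSpace Ω']
    (P P' : Measure Ω) (Q : Measure Ω') [IsProbabilityMeasure P] [IsProbabilityMeasure P']
    [IsProbabilityMeasure Q] {α : ℝ} (hα : 0 ≤ α) :
    tradeOff P P' α ≤ tradeOff (Q.prod P) (Q.prod P') α := by
  refine tradeOff_le_of_forall_exists hα fun φ hφ hφ01 =>
    ⟨fun y => ∫ x, φ (x, y) ∂Q, ?_, fun y => integral_mem_Icc_of_forall_mem_Icc Q fun x => hφ01 _,
      ?_, ?_⟩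
  · exact hφ.stronglyMeasurable.integral_prod_left'.measurable
  · exact (integral_prod_symm φ (integrable_of_forall_mem_Icc _ hφ hφ01)).symm
  · exact (integral_prod_symm φ (integrable_of_forall_mem_Icc _ hφ hφ01)).symm

theorem Neighboring.filter_eq_or_filter_eq {X : Type*} {D D' : Multiset X}
    (h : Neighboring D D') {s t : Set X} [DecidablePred (· ∈ s)] [DecidablePred (· ∈ t)]
    (hst : Disjoint s t) :
    D.filter (· ∈ s) = D'.filter (· ∈ s) ∨ D.filter (· ∈ t) = D'.filter (· ∈ t) := by
  obtain ⟨x, hx⟩ := h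
  by_cases hxs : x ∈ s
  · have hxt : x ∉ t := Set.disjoint_left.1 hst hxs
    right
    rcases hx with rfl | rfl <;> simp [Multiset.filter_singleton, hxt]
  · left
    rcases hx with rfl | rfl <;> simp [Multiset.filter_singleton, hxs]

/-- Parallel composition in `f`-differential privacy (non-adaptive form): if
`M₁` restricted to `𝔻₁` is `f₁`-DP and `M₂` restricted to `𝔻₂` is `f₂`-DP, with
`𝔻₁, 𝔻₂` disjoint, then the joint mechanism `D ↦ M₁(D ∩ 𝔻₁) × M₂(D ∩ 𝔻₂)` is
`min(f₁, f₂)`-DP. -/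
theorem parallel_composition_fDP {X R₁ R₂ : Type*}
    [MeasurableSpace R₁] [MeasurableSpace R₂]
    (𝔻₁ 𝔻₂ : Set X) [DecidablePred (· ∈ 𝔻₁)] [DecidablePred (· ∈ 𝔻₂)]
    (hdisj : Disjoint 𝔻₁ 𝔻₂)
    (M₁ : Multiset X → Measure R₁) (M₂ : Multiset X → Measure R₂)
    [∀ D, IsProbabilityMeasure (M₁ D)] [∀ D, IsProbabilityMeasure (M₂ D)]
    (f₁ f₂ : ℝ → ℝ)
    (hM₁ : ∀ D D' : Multiset X, Neighboring D D' → ∀ α ∈ Set.Icc (0 : ℝ) 1,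
      f₁ α ≤ tradeOff (M₁ (D.filter (· ∈ 𝔻₁))) (M₁ (D'.filter (· ∈ 𝔻₁))) α)
    (hM₂ : ∀ D D' : Multiset X, Neighboring D D' → ∀ α ∈ Set.Icc (0 : ℝ) 1,
      f₂ α ≤ tradeOff (M₂ (D.filter (· ∈ 𝔻₂))) (M₂ (D'.filter (· ∈ 𝔻₂))) α) :
    ∀ D D' : Multiset X, Neighboring D D' → ∀ α ∈ Set.Icc (0 : ℝ) 1,
      min (f₁ α) (f₂ α) ≤
        tradeOff ((M₁ (D.filter (· ∈ 𝔻₁))).prod (M₂ (D.filter (· ∈ 𝔻₂))))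
          ((M₁ (D'.filter (· ∈ 𝔻₁))).prod (M₂ (D'.filter (· ∈ 𝔻₂)))) α := by
  intro D D' hD α hα
  rcases hD.filter_eq_or_filter_eq hdisj with h | h
  · rw [h]
    exact (min_le_right _ _).trans
      ((hM₂ D D' hD α hα).trans (tradeOff_le_tradeOff_prod_left _ _ _ hα.1))
  · rw [h]
    exact (min_le_left _ _).trans
      ((hM₁ D D' hD α hα).trans (tradeOff_le_tradeOff_prod_right _ _ _ hα.1))
end

section
/- Heterogeneous parallel composition for ε-differential privacy (non-adaptive form): Let 𝔻₁,…,𝔻_k be pairwise disjoint subsets of the row set X. For each i ∈ {1,…,k} let Mᵢ map each data set to a probability measure on a measurable space Rᵢ, let εᵢ ≥ 0, and suppose that for all neighboring data sets D, D′ and all measurable S ⊆ Rᵢ, Mᵢ(D ∩ 𝔻ᵢ)(S) ≤ e^{εᵢ} · Mᵢ(D′ ∩ 𝔻ᵢ)(S). Then the product mechanism M(D) := ⨂ᵢ Mᵢ(D ∩ 𝔻ᵢ) satisfies, for all neighboring D, D′ and all measurable S ⊆ R₁ × ⋯ × R_k, M(D)(S) ≤ e^{max{ε₁,…,ε_k}}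 · M(D′)(S). -/
open MeasureTheory

/-- A bound between product measures by a finite nonzero factor may be checked on one coordinate
when all the other factors agree. -/
theorem pi_le_mul_pi_of_eq_off {ι : Type*} [Fintype ι] {R : ι → Type*}
    [∀ i, MeasurableSpace (R i)] (μ ν : ∀ i, Measure (R i))
    [∀ i, SigmaFinite (μ i)] {c : ENNReal} (hc : c ≠ 0) (hc' : c ≠ ⊤) (j : ι)
    (hoff : ∀ i, i ≠ j → μ i = ν i) (hj : μ j ≤ c • ν j)
    {S : Set (∀ i, R i)} (hS : MeasurableSet S) :
    Measure.pi μ S ≤ c * Measure.pi ν S := by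
  classical
  have key : c⁻¹ • (Measure.pi μ).toOuterMeasure ≤
      OuterMeasure.pi fun i => (ν i).toOuterMeasure := by
    refine OuterMeasure.le_pi.2 fun s hs => ?_
    rw [smul_apply, Measure.coe_toOuterMeasure,
      Measure.pi_pi, smul_eq_mul, ENNReal.inv_mul_le_iff hc hc']
    simp only [Measure.coe_toOuterMeasure]
    rw [← Finset.mul_prod_erase _ _ (Finset.mem_univ j),
      ← Finset.mul_prod_erase _ _ (Finset.mem_univ j), ← mul_assoc]
    refine mul_le_mul' (by simpa using hj (s j)) (Finset.prod_congr rfl fun i hi => ?_).le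
    rw [hoff i (Finset.ne_of_mem_erase hi)]
  rw [← ENNReal.inv_mul_le_iff hc hc']
  refine (key S).trans_eq ?_
  rw [Measure.pi, toMeasure_apply _ _ hS]

/-- Among pairwise disjoint parts, neighboring data sets differ on at most one. -/
theorem Neighboring.exists_filter_eq_off {X ι : Type*} [Nonempty ι]
    {𝔻 : ι → Set X} [∀ i, DecidablePred (· ∈ 𝔻 i)]
    (hdisj : ∀ i j, i ≠ j → Disjoint (𝔻 i) (𝔻 j)) {D D' : Multiset X}
    (h : Neighboring D D') :
    ∃ j, ∀ i, i ≠ j → D.filter (· ∈ 𝔻 i) = D'.filter (· ∈ 𝔻 i) := by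
  obtain ⟨x, hx⟩ := h
  obtain ⟨j, hj⟩ : ∃ j, ∀ i, i ≠ j → x ∉ 𝔻 i := by
    by_cases hex : ∃ j, x ∈ 𝔻 j
    · obtain ⟨j, hj⟩ := hex
      exact ⟨j, fun i hij hi => Set.disjoint_left.1 (hdisj i j hij) hi hj⟩
    · exact ⟨Classical.arbitrary ι, fun i _ hi => hex ⟨i, hi⟩⟩
  refine ⟨j, fun i hij => ?_⟩
  rcases hx with rfl | rfl <;> simp [Multiset.filter_add, Multiset.filter_singleton, hj i hij]

/-- Heterogeneous parallel composition for `ε`-differential privacy (non-adaptive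
form): if the subsets `𝔻 i` of the row set are pairwise disjoint and each mechanism
`M i`, run on `D ∩ 𝔻 i`, is `ε i`-DP, then the product mechanism
`D ↦ ⨂ᵢ Mᵢ(D ∩ 𝔻ᵢ)` is `max ε i`-DP. -/
theorem heterogeneous_parallel_composition {X ι : Type*} [Fintype ι] [Nonempty ι]
    {R : ι → Type*} [∀ i, MeasurableSpace (R i)]
    (𝔻 : ι → Set X) [∀ i, DecidablePred (· ∈ 𝔻 i)]
    (hdisj : ∀ i j, i ≠ j → Disjoint (𝔻 i) (𝔻 j))
    (M : ∀ i, Multiset X → Measure (R i))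
    [∀ i, ∀ D : Multiset X, IsProbabilityMeasure (M i D)]
    (ε : ι → ℝ) (hε : ∀ i, 0 ≤ ε i)
    (hDP : ∀ i, ∀ D D' : Multiset X, Neighboring D D' →
      ∀ S : Set (R i), MeasurableSet S →
        M i (D.filter (· ∈ 𝔻 i)) S ≤
          ENNReal.ofReal (Real.exp (ε i)) * M i (D'.filter (· ∈ 𝔻 i)) S) :
    ∀ D D' : Multiset X, Neighboring D D' →
      ∀ S : Set (∀ i, R i), MeasurableSet S →
        Measure.pi (fun i => M i (D.filter (· ∈ 𝔻 i))) S ≤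
          ENNReal.ofReal (Real.exp (Finset.univ.sup' Finset.univ_nonempty ε)) *
            Measure.pi (fun i => M i (D'.filter (· ∈ 𝔻 i))) S := by
  intro D D' hD S hS
  obtain ⟨j, hj⟩ := hD.exists_filter_eq_off hdisj
  refine pi_le_mul_pi_of_eq_off _ _ (by simp [Real.exp_pos]) ENNReal.ofReal_ne_top j
    (fun i hij => by rw [hj i hij]) (Measure.le_iff.2 fun T hT => ?_) hS
  refine (hDP j D D' hD T hT).trans ?_
  rw [Measure.smul_apply, smul_eq_mul]
  gcongr
  exact Finset.le_sup' ε (Finset.mem_univ j)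
end

section
/- Maximum weight overlap equals ℓ₁-sensitivity under the consistency condition: let Q be a finite set of queries from data sets to ℝ, and for each q ∈ Q let Δq ∈ ℝ be such that (i) |q(D + {x}) − q(D)| ≤ Δq for every data set D and row x, (ii) whenever q(D + {x}) ≠ q(D), |q(D + {x}) − q(D)| = Δq (consistency condition), and (iii) for each row x, if q(D + {x}) ≠ q(D) holds for some data set D then it holds for every data set D. Then γ_w(Q) = ΔQ, where ΔQ := sup{ Σ_{q∈Q} |q(D + {x}) − q(D)| : D a data set, x ∈ X } is the ℓ₁-sensitivity of Q and γ_w(Q) := max{ Σ_{q∈Q′} Δq : Q′ ⊆ Q, ⋂_{q∈Q′} C(q) ≠ ∅ }. -/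
open Classical

/-- Maximum weight overlap equals `ℓ₁`-sensitivity under the consistency condition:
for a finite set `Q` of queries (functions from data sets — finite multisets over
the nonempty row set `X` — to `ℝ`), if each query `q` has `Δq` such that (i) the
change of `q` upon adding a row is at most `Δq` in absolute value, (ii) any nonzero
change has absolute value exactly `Δq`, and (iii) whether adding a row `x` changes
the answer does not depend on the data set, then
`γ_w(Q) = max{∑_{q ∈ Q'} Δq : Q' ⊆ Q, ⋂_{q ∈ Q'} C(q) ≠ ∅}` equals the
`ℓ₁`-sensitivity `ΔQ = sup{∑_{q ∈ Q} |q(D + {x}) − q(D)| : D, x}`, where the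
coverage is `C(q) = {x : ∃ D, q(D + {x}) ≠ q(D)}` and the empty intersection of
coverages is all of `X`. -/
theorem maxWeightOverlap_eq_l1Sensitivity {X ι : Type*} [Nonempty X]
    (Q : Finset ι) (qf : ι → Multiset X → ℝ) (Δ : ι → ℝ)
    (C : ι → Set X)
    (hC : ∀ q, C q = {x : X | ∃ D : Multiset X, qf q (D + {x}) ≠ qf q D})
    (hbound : ∀ q ∈ Q, ∀ (D : Multiset X) (x : X),
      |qf q (D + {x}) - qf q D| ≤ Δ q)
    (hconsistent : ∀ q ∈ Q, ∀ (D : Multiset X) (x : X),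
      qf q (D + {x}) ≠ qf q D → |qf q (D + {x}) - qf q D| = Δ q)
    (hcover : ∀ q ∈ Q, ∀ x : X,
      (∃ D : Multiset X, qf q (D + {x}) ≠ qf q D) →
        ∀ D : Multiset X, qf q (D + {x}) ≠ qf q D)
    (O₁ : Finset (Finset ι))
    (hO₁ : O₁ = Q.powerset.filter fun Q' => (⋂ q ∈ Q', C q).Nonempty)
    (h₁ : O₁.Nonempty) :
    O₁.sup' h₁ (fun Q' => ∑ q ∈ Q', Δ q) =
      sSup {r : ℝ | ∃ (D : Multiset X) (x : X),
        r = ∑ q ∈ Q, |qf q (D + {x}) - qf q D|} := by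
  subst hO₁
  refine le_antisymm (Finset.sup'_le _ _ fun Q' hQ' => ?_)
    (csSup_le ⟨_, 0, Classical.arbitrary X, rfl⟩ ?_)
  · obtain ⟨hsub, x, hx⟩ := Finset.mem_filter.1 hQ'
    rw [Finset.mem_powerset] at hsub
    refine le_csSup_of_le (b := ∑ q ∈ Q, |qf q (0 + {x}) - qf q 0|) ⟨∑ q ∈ Q, Δ q, ?_⟩
      ⟨0, x, rfl⟩ ?_
    · rintro _ ⟨D, y, rfl⟩
      exact Finset.sum_le_sum fun q hq => hbound q hq D y
    · calc ∑ q ∈ Q', Δ q = ∑ q ∈ Q', |qf q (0 + {x}) - qf q 0| := by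
            refine Finset.sum_congr rfl fun q hq => ?_
            have hxq := Set.mem_iInter₂.1 hx q hq
            rw [hC] at hxq
            exact (hconsistent q (hsub hq) 0 x (hcover q (hsub hq) x hxq 0)).symm
        _ ≤ ∑ q ∈ Q, |qf q (0 + {x}) - qf q 0| :=
            Finset.sum_le_sum_of_subset_of_nonneg hsub fun _ _ _ => abs_nonneg _
  · rintro _ ⟨D, x, rfl⟩
    have hmem : Q.filter (fun q => qf q (D + {x}) ≠ qf q D) ∈
        Q.powerset.filter fun Q' => (⋂ q ∈ Q', C q).Nonempty := by
      refine Finset.mem_filter.2 ⟨Finset.mem_powerset.2 (Finset.filter_subset _ _), x, ?_⟩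
      refine Set.mem_iInter₂.2 fun q hq => ?_
      rw [hC]
      exact ⟨D, (Finset.mem_filter.1 hq).2⟩
    refine le_trans (le_of_eq ?_) (Finset.le_sup' (fun Q' => ∑ q ∈ Q', Δ q) hmem)
    rw [Finset.sum_filter]
    refine Finset.sum_congr rfl fun q hq => ?_
    split_ifs with h
    · exact hconsistent q hq D x h
    · rw [not_not.1 h, sub_self, abs_zero]
end

section
/- Correctness of the Max Cut reduction: let G be a finite simple graph on vertex set V and let k be a positive integer. For every assignment x : V → Bool, the number of ordered pairs (u,v) with u adjacent to v in G, x(u) = false and x(v) = true equals the number of edges of G crossing the cut determined by S = {v ∈ V : x(v) = true} (edges with exactly one endpoint in S). Consequently, there exists S ⊆ V such that at least k edges of G cross the cut (S, V∖S) if and only if there exists an assignment x : V → Bool under which at least k of the queries {¬φ_u ∧ φ_v : u adjacent to v} — one per ordered adjacent pair (u,v), satisfied when x(u) = false and x(v) = true — are simultaneously satisfied. -/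
/-- Orienting each cut edge from its `false` endpoint to its `true` endpoint is a bijection
between cut edges and satisfied queries. -/
theorem SimpleGraph.card_satisfied_eq_card_crossing {V : Type*} [Fintype V] [DecidableEq V]
    (G : SimpleGraph V) [DecidableRel G.Adj] (x : V → Bool) :
    (Finset.univ.filter fun p : V × V =>
        G.Adj p.1 p.2 ∧ x p.1 = false ∧ x p.2 = true).card =
      (G.edgeFinset.filter fun e => ∃ u v, e = s(u, v) ∧
        ((x u = true ∧ x v = false) ∨ (x u = false ∧ x v = true))).card := by
  refine Finset.card_bij (fun p _ => s(p.1, p.2)) ?_ ?_ ?_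
  · rintro ⟨u, v⟩ h
    obtain ⟨hadj, hu, hv⟩ := (Finset.mem_filter.1 h).2
    exact Finset.mem_filter.2
      ⟨SimpleGraph.mem_edgeFinset.2 hadj, u, v, rfl, Or.inr ⟨hu, hv⟩⟩
  · rintro ⟨u, v⟩ h ⟨u', v'⟩ h' heq
    obtain ⟨-, hu, -⟩ := (Finset.mem_filter.1 h).2
    obtain ⟨-, -, hv'⟩ := (Finset.mem_filter.1 h').2
    rcases Sym2.eq_iff.1 heq with ⟨rfl, rfl⟩ | ⟨rfl, rfl⟩
    · rfl
    · simp_all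
  · intro e he
    obtain ⟨hmem, u, v, rfl, ⟨hu, hv⟩ | ⟨hu, hv⟩⟩ := Finset.mem_filter.1 he
    · have hadj : G.Adj u v := SimpleGraph.mem_edgeFinset.1 hmem
      exact ⟨(v, u), Finset.mem_filter.2 ⟨Finset.mem_univ _, hadj.symm, hv, hu⟩, Sym2.eq_swap⟩
    · have hadj : G.Adj u v := SimpleGraph.mem_edgeFinset.1 hmem
      exact ⟨(u, v), Finset.mem_filter.2 ⟨Finset.mem_univ _, hadj, hu, hv⟩, rfl⟩

/-- Correctness of the Max Cut reduction. (1) For every assignment `x : V → Bool`,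
the number of ordered pairs `(u, v)` of adjacent vertices with `x u = false` and
`x v = true` (the queries `¬φ_u ∧ φ_v` satisfied by `x`) equals the number of edges
crossing the cut determined by `S = {v : x v = true}` (edges with exactly one
endpoint in `S`). (2) Consequently, there is `S ⊆ V` with at least `k` edges
crossing the cut `(S, V ∖ S)` iff there is an assignment `x : V → Bool` under which
at least `k` of the queries — one per ordered adjacent pair `(u, v)`, satisfied when
`x u = false` and `x v = true` — are simultaneously satisfied. -/
theorem maxCut_reduction_correct {V : Type*} [Fintype V] [DecidableEq V]
    (G : SimpleGraph V) [DecidableRel G.Adj] (k : ℕ) (hk : 0 < k) :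
    (∀ x : V → Bool,
      (Finset.univ.filter fun p : V × V =>
          G.Adj p.1 p.2 ∧ x p.1 = false ∧ x p.2 = true).card =
        (G.edgeFinset.filter fun e => ∃ u v, e = s(u, v) ∧
          ((x u = true ∧ x v = false) ∨ (x u = false ∧ x v = true))).card) ∧
    ((∃ S : Finset V, k ≤ (G.edgeFinset.filter fun e => ∃ u v, e = s(u, v) ∧
          ((u ∈ S ∧ v ∉ S) ∨ (u ∉ S ∧ v ∈ S))).card) ↔
      (∃ x : V → Bool, k ≤ (Finset.univ.filter fun p : V × V =>
          G.Adj p.1 p.2 ∧ x p.1 = false ∧ x p.2 = true).card)) := by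
  refine ⟨G.card_satisfied_eq_card_crossing, ?_, ?_⟩
  · rintro ⟨S, hS⟩
    refine ⟨fun v => decide (v ∈ S), ?_⟩
    refine le_of_le_of_eq ?_ (G.card_satisfied_eq_card_crossing fun v => decide (v ∈ S)).symm
    simpa only [decide_eq_true_eq, decide_eq_false_iff_not] using hS
  · rintro ⟨x, hx⟩
    refine ⟨Finset.univ.filter fun v => x v = true, ?_⟩
    rw [G.card_satisfied_eq_card_crossing] at hx
    simpa only [Finset.mem_filter, Finset.mem_univ, true_and, Bool.not_eq_true] using hx
end
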